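/- For all Borel probability measures μ and ν on ℝ there exists a unique Borel probability measure λ on ℝ such that for all z ∈ ℂ⁺: G_λ(z) = G_μ(z)·G_ν(z) / (G_μ(z)+G_ν(z)−z·G_μ(z)·G_ν(z)) (equivalently, 1/G_λ(z) = 1/G_μ(z) + 1/G_ν(z) − z). The measure λ is the additive boolean convolution μ ⊎ ν. -/

import Mathlib

open MeasureTheory

/-- The Cauchy transform `G_ρ(z) = ∫ 1/(z−t) dρ(t)` of a measure on `ℝ`. -/
noncomputable def cauchyTransform (ρ : Measure ℝ) (z : ℂ) : ℂ := ∫ t, (z - (t : ℂ))⁻¹ ∂ρ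

theorem im_le_norm_sub_ofReal (z : ℂ) (t : ℝ) : z.im ≤ ‖z - t‖ := by
  have := Complex.abs_im_le_norm (z - t)
  simp only [Complex.sub_im, Complex.ofReal_im, sub_zero] at this
  exact (le_abs_self _).trans this

theorem sub_ofReal_ne_zero {z : ℂ} (hz : 0 < z.im) (t : ℝ) : z - t ≠ 0 :=
  norm_pos_iff.1 (hz.trans_le (im_le_norm_sub_ofReal z t))

theorem norm_inv_sub_ofReal_le {z : ℂ} (hz : 0 < z.im) (t : ℝ) : ‖(z - t)⁻¹‖ ≤ z.im⁻¹ := by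
  rw [norm_inv]
  exact inv_anti₀ hz (im_le_norm_sub_ofReal z t)

theorem continuous_inv_sub_ofReal {z : ℂ} (hz : 0 < z.im) :
    Continuous fun t : ℝ => (z - t)⁻¹ :=
  Continuous.inv₀ (by fun_prop) fun t => sub_ofReal_ne_zero hz t

theorem integrable_inv_sub_ofReal (ρ : Measure ℝ) [IsFiniteMeasure ρ] {z : ℂ} (hz : 0 < z.im) :
    Integrable (fun t : ℝ => (z - t)⁻¹) ρ :=
  Integrable.of_bound (continuous_inv_sub_ofReal hz).aestronglyMeasurable _
    (Filter.Eventually.of_forall fun t => norm_inv_sub_ofReal_le hz t)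

theorem neg_im_inv_sub_ofReal (z : ℂ) (t : ℝ) :
    -((z - t)⁻¹).im = z.im * ‖(z - t)⁻¹‖ ^ 2 := by
  rw [Complex.inv_im, norm_inv, inv_pow, ← Complex.normSq_eq_norm_sq]
  simp [div_eq_mul_inv]

theorem neg_im_cauchyTransform (ρ : Measure ℝ) [IsFiniteMeasure ρ] {z : ℂ} (hz : 0 < z.im) :
    -(cauchyTransform ρ z).im = ∫ t : ℝ, z.im * ‖(z - t)⁻¹‖ ^ 2 ∂ρ := by
  have h := integral_im (𝕜 := ℂ) (integrable_inv_sub_ofReal ρ hz)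
  simp only [RCLike.im_eq_complex_im] at h
  rw [cauchyTransform, ← h, ← integral_neg]
  exact integral_congr_ae (Filter.Eventually.of_forall fun t => neg_im_inv_sub_ofReal z t)

theorem integrable_norm_inv_sub_ofReal_sq (ρ : Measure ℝ) [IsFiniteMeasure ρ] {z : ℂ}
    (hz : 0 < z.im) : Integrable (fun t : ℝ => ‖(z - t)⁻¹‖ ^ 2) ρ := by
  refine Integrable.of_bound
    ((continuous_inv_sub_ofReal hz).norm.pow 2).aestronglyMeasurable (z.im⁻¹ ^ 2)
    (Filter.Eventually.of_forall fun t => ?_)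
  rw [norm_pow, norm_norm]
  gcongr
  exact norm_inv_sub_ofReal_le hz t

theorem im_mul_norm_cauchyTransform_sq_le (ρ : Measure ℝ) [IsProbabilityMeasure ρ] {z : ℂ}
    (hz : 0 < z.im) :
    z.im * ‖cauchyTransform ρ z‖ ^ 2 ≤ -(cauchyTransform ρ z).im := by
  rw [neg_im_cauchyTransform ρ hz, integral_const_mul]
  refine mul_le_mul_of_nonneg_left ?_ hz.le
  have hconv : ConvexOn ℝ Set.univ fun w : ℂ => ‖w‖ ^ 2 :=
    (convexOn_norm convex_univ).pow (fun _ _ => norm_nonneg _) 2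
  exact hconv.map_integral_le (by fun_prop) isClosed_univ (by simp)
    (integrable_inv_sub_ofReal ρ hz) (integrable_norm_inv_sub_ofReal_sq ρ hz)

theorem im_cauchyTransform_neg (ρ : Measure ℝ) [IsProbabilityMeasure ρ] {z : ℂ}
    (hz : 0 < z.im) : (cauchyTransform ρ z).im < 0 := by
  rw [← neg_pos, neg_im_cauchyTransform ρ hz]
  have hpos : ∀ t : ℝ, 0 < z.im * ‖(z - t)⁻¹‖ ^ 2 := fun t =>
    mul_pos hz (pow_pos (norm_pos_iff.2 (inv_ne_zero (sub_ofReal_ne_zero hz t))) 2)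
  rw [integral_pos_iff_support_of_nonneg (fun t => (hpos t).le)
    ((integrable_norm_inv_sub_ofReal_sq ρ hz).const_mul _)]
  have : (Function.support fun t : ℝ => z.im * ‖(z - t)⁻¹‖ ^ 2) = Set.univ :=
    Set.eq_univ_of_forall fun t => (hpos t).ne'
  rw [this]
  simp

theorem cauchyTransform_ne_zero (ρ : Measure ℝ) [IsProbabilityMeasure ρ] {z : ℂ}
    (hz : 0 < z.im) : cauchyTransform ρ z ≠ 0 := fun h => by
  have := im_cauchyTransform_neg ρ hz
  simp [h] at this

theorem im_le_im_inv_cauchyTransform (ρ : Measure ℝ) [IsProbabilityMeasure ρ] {z : ℂ}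
    (hz : 0 < z.im) : z.im ≤ ((cauchyTransform ρ z)⁻¹).im := by
  have h0 : 0 < ‖cauchyTransform ρ z‖ := norm_pos_iff.2 (cauchyTransform_ne_zero ρ hz)
  rw [Complex.inv_im, Complex.normSq_eq_norm_sq, le_div_iff₀ (by positivity)]
  exact im_mul_norm_cauchyTransform_sq_le ρ hz

theorem differentiableOn_cauchyTransform (ρ : Measure ℝ) [IsFiniteMeasure ρ] :
    DifferentiableOn ℂ (cauchyTransform ρ) {z | 0 < z.im} := by
  have h : cauchyTransform ρ = fun z => -resolventTransform ρ z := by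
    ext z
    rw [cauchyTransform, resolventTransform_apply, ← integral_neg]
    refine integral_congr_ae (Filter.Eventually.of_forall fun t => ?_)
    simp only [resolvent, Ring.inverse_eq_inv', Complex.coe_algebraMap]
    rw [← inv_neg, neg_sub]
  rw [h]
  intro z hz
  refine (hasDerivAt_resolventTransform z ?_).differentiableAt.neg.differentiableWithinAt
  rintro ⟨t, -, rfl⟩
  simp at hz

open Filter Topology in
theorem tendsto_mul_cauchyTransform (ρ : Measure ℝ) [IsProbabilityMeasure ρ] :
    Tendsto (fun y : ℝ => y * Complex.I * cauchyTransform ρ (y * Complex.I)) atTop (𝓝 1) := by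
  have h1 : ∀ y : ℝ, y * Complex.I * cauchyTransform ρ (y * Complex.I)
      = ∫ t : ℝ, y * Complex.I * (y * Complex.I - t)⁻¹ ∂ρ := fun y => by
    rw [cauchyTransform, integral_const_mul]
  simp only [h1]
  have h2 : (1 : ℂ) = ∫ t : ℝ, (1 : ℂ) ∂ρ := by simp
  rw [h2]
  refine tendsto_integral_filter_of_dominated_convergence (fun _ => (1 : ℝ)) ?_ ?_
    (integrable_const _) ?_
  · filter_upwards [eventually_gt_atTop 0] with y hy
    exact ((continuous_inv_sub_ofReal (by simpa using hy)).const_mul _).aestronglyMeasurable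
  · filter_upwards [eventually_gt_atTop 0] with y hy
    refine Eventually.of_forall fun t => ?_
    have := norm_inv_sub_ofReal_le (z := y * Complex.I) (by simpa using hy) t
    rw [norm_mul]
    simp only [norm_mul, Complex.norm_real, Complex.norm_I, mul_one, Real.norm_eq_abs,
      abs_of_pos hy]
    calc y * ‖((y : ℂ) * Complex.I - t)⁻¹‖ ≤ y * y⁻¹ := by gcongr; simpa using this
      _ = 1 := mul_inv_cancel₀ hy.ne'
  · refine Eventually.of_forall fun t => ?_
    have h3 : Tendsto (fun y : ℝ => ((y : ℂ) * Complex.I)⁻¹) atTop (𝓝 0) := by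
      rw [tendsto_zero_iff_norm_tendsto_zero]
      simpa [Function.comp_def] using tendsto_inv_atTop_zero.comp (tendsto_abs_atTop_atTop (G := ℝ))
    have h4 : Tendsto (fun y : ℝ => (1 - t * ((y : ℂ) * Complex.I)⁻¹)⁻¹) atTop (𝓝 1) := by
      simpa using ((h3.const_mul (t : ℂ)).const_sub 1).inv₀ (by simp)
    refine h4.congr' ?_
    filter_upwards [eventually_gt_atTop 0] with y hy
    have h5 : (y : ℂ) * Complex.I ≠ 0 := by simp [hy.ne']
    rw [← inv_inv ((y : ℂ) * Complex.I), ← mul_inv, inv_inv]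
    congr 1
    rw [inv_inv, mul_sub, inv_mul_cancel₀ h5, mul_comm]

open scoped ENNReal NNReal in
/-- Smoothing a bounded function by the Cauchy density, in terms of `z ↦ |z - t|⁻²`. -/
theorem lintegral_comp_add_mul_cauchy (f : ℝ → ℝ≥0∞) {y : ℝ} (hy : 0 < y) (t : ℝ) :
    ∫⁻ s : ℝ, f (t + y * s) * ENNReal.ofReal ((1 + s ^ 2)⁻¹)
      = ∫⁻ x : ℝ, f x * ENNReal.ofReal (y * ‖(x + y * Complex.I - t)⁻¹‖ ^ 2) := by
  have hemb : MeasurableEmbedding fun s : ℝ => y * s :=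
    (Homeomorph.mulLeft₀ y hy.ne').measurableEmbedding
  rw [← lintegral_add_left_eq_self (fun x : ℝ => f x * _) t]
  have h1 : ∀ u : ℝ, y * ‖((t + u : ℝ) + y * Complex.I - t)⁻¹‖ ^ 2
      = y⁻¹ * (1 + (y⁻¹ * u) ^ 2)⁻¹ := fun u => by
    have h2 : ((t + u : ℝ) + y * Complex.I - t : ℂ) = u + y * Complex.I := by push_cast; ring
    rw [h2, norm_inv, inv_pow, ← Complex.normSq_eq_norm_sq, Complex.normSq_add_mul_I]
    field_simp
    ring
  have h3 := hemb.lintegral_map (μ := volume)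
    fun u => f (t + u) * ENNReal.ofReal ((1 + (y⁻¹ * u) ^ 2)⁻¹)
  rw [Real.map_volume_mul_left hy.ne', lintegral_smul_measure, abs_of_pos (inv_pos.2 hy),
    smul_eq_mul, ← lintegral_const_mul' _ _ ENNReal.ofReal_ne_top] at h3
  simp only [inv_mul_cancel_left₀ hy.ne'] at h3
  rw [← h3]
  refine lintegral_congr fun u => ?_
  rw [h1, ENNReal.ofReal_mul (inv_pos.2 hy).le, mul_left_comm]

open scoped ENNReal NNReal in
theorem lintegral_lintegral_cauchy (ρ : Measure ℝ) [IsFiniteMeasure ρ] {f : ℝ → ℝ≥0∞}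
    (hf : Measurable f) {y : ℝ} (hy : 0 < y) :
    ∫⁻ t, (∫⁻ s : ℝ, f (t + y * s) * ENNReal.ofReal ((1 + s ^ 2)⁻¹)) ∂ρ
      = ∫⁻ x : ℝ, f x * ENNReal.ofReal (-(cauchyTransform ρ (x + y * Complex.I)).im) := by
  simp only [lintegral_comp_add_mul_cauchy f hy]
  rw [lintegral_lintegral_swap (by fun_prop)]
  refine lintegral_congr fun x => ?_
  have hz : 0 < ((x : ℂ) + y * Complex.I).im := by simpa using hy
  rw [lintegral_const_mul _ (by fun_prop), neg_im_cauchyTransform ρ hz,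
    ofReal_integral_eq_lintegral_ofReal ((integrable_norm_inv_sub_ofReal_sq ρ hz).const_mul _)
      (Filter.Eventually.of_forall fun t => by positivity)]
  simp

open Filter Topology in
/-- Stieltjes inversion in weak form: the smoothings recover `π • ρ`. -/
theorem tendsto_lintegral_lintegral_cauchy (ρ : Measure ℝ) [IsFiniteMeasure ρ]
    (f : BoundedContinuousFunction ℝ NNReal) :
    Tendsto (fun n : ℕ => ∫⁻ t, (∫⁻ s : ℝ, (f (t + 1 / ((n : ℝ) + 1) * s) : ENNReal) *
        ENNReal.ofReal ((1 + s ^ 2)⁻¹)) ∂ρ) atTop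
      (𝓝 (∫⁻ t, f t * ENNReal.ofReal Real.pi ∂ρ)) := by
  have hpi : ∫⁻ s : ℝ, ENNReal.ofReal ((1 + s ^ 2)⁻¹) = ENNReal.ofReal Real.pi := by
    rw [← integral_univ_inv_one_add_sq, ofReal_integral_eq_lintegral_ofReal
      integrable_inv_one_add_sq (Eventually.of_forall fun s => by positivity)]
  have hb : ∀ x, (f x : ENNReal) ≤ (nndist f 0 : ENNReal) := fun x => by
    exact_mod_cast BoundedContinuousFunction.NNReal.upper_bound f x
  have hf : Measurable fun x => f x := f.continuous.measurable
  refine tendsto_lintegral_of_dominated_convergence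
    (fun _ => (nndist f 0 : ENNReal) * ENNReal.ofReal Real.pi) (fun n => ?_) (fun n => ?_) ?_ ?_
  · exact Measurable.lintegral_prod_right' (f := fun p : ℝ × ℝ =>
      (f (p.1 + 1 / ((n : ℝ) + 1) * p.2) : ENNReal) * ENNReal.ofReal ((1 + p.2 ^ 2)⁻¹))
      (by fun_prop)
  · refine Eventually.of_forall fun t => ?_
    rw [← hpi, ← lintegral_const_mul _ (by fun_prop)]
    exact lintegral_mono fun s => mul_le_mul_left (hb _) _
  · rw [lintegral_const]
    finiteness
  · refine Eventually.of_forall fun t => ?_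
    rw [← hpi, ← lintegral_const_mul _ (by fun_prop)]
    refine tendsto_lintegral_of_dominated_convergence
      (fun s => (nndist f 0 : ENNReal) * ENNReal.ofReal ((1 + s ^ 2)⁻¹))
      (fun n => by fun_prop) (fun n => Eventually.of_forall fun s => mul_le_mul_left (hb _) _)
      ?_ ?_
    · rw [lintegral_const_mul _ (by fun_prop), hpi]
      finiteness
    · refine Eventually.of_forall fun s => ?_
      refine ENNReal.Tendsto.mul_const ?_ (Or.inr ENNReal.ofReal_ne_top)
      refine (ENNReal.continuous_coe.tendsto _).comp ((f.continuous.tendsto _).comp ?_)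
      simpa using (tendsto_one_div_add_atTop_nhds_zero_nat (𝕜 := ℝ)).mul_const s |>.const_add t

/-- A finite measure on `ℝ` is determined by its Cauchy transform on the upper half-plane. -/
theorem Measure.ext_of_cauchyTransform {ρ σ : Measure ℝ} [IsFiniteMeasure ρ] [IsFiniteMeasure σ]
    (h : ∀ z : ℂ, 0 < z.im → cauchyTransform ρ z = cauchyTransform σ z) : ρ = σ := by
  refine ext_of_forall_lintegral_eq_of_IsFiniteMeasure fun f => ?_
  have hf : Measurable fun x => (f x : ENNReal) := f.continuous.measurable.coe_nnreal_ennreal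
  have h1 := tendsto_lintegral_lintegral_cauchy ρ f
  have h2 := tendsto_lintegral_lintegral_cauchy σ f
  have h3 : ∀ n : ℕ, 0 < 1 / ((n : ℝ) + 1) := fun n => by positivity
  have h4 := fun n : ℕ => lintegral_lintegral_cauchy ρ hf (h3 n)
  have h5 := fun n : ℕ => lintegral_lintegral_cauchy σ hf (h3 n)
  have h6 : ∀ (n : ℕ) (x : ℝ), cauchyTransform ρ (x + (1 / ((n : ℝ) + 1) : ℝ) * Complex.I)
      = cauchyTransform σ (x + (1 / ((n : ℝ) + 1) : ℝ) * Complex.I) := fun n x =>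
    h _ (by
      rw [Complex.add_im, Complex.ofReal_im, Complex.im_ofReal_mul, Complex.I_im, zero_add, mul_one]
      exact h3 n)
  simp only [h4, h6] at h1
  simp only [h5] at h2
  have h7 := tendsto_nhds_unique h1 h2
  rw [lintegral_mul_const _ hf, lintegral_mul_const _ hf] at h7
  exact (ENNReal.mul_left_inj (by simp [Real.pi_pos]) ENNReal.ofReal_ne_top).1 h7

open Metric in
theorem continuous_poissonKernel_sphere {w : ℂ} (hw : w ∈ ball (0 : ℂ) 1) :
    Continuous fun ζ : sphere (0 : ℂ) 1 => poissonKernel 0 w ζ := by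
  simp only [poissonKernel_def, sub_zero]
  refine Continuous.div (by fun_prop) (by fun_prop) fun ζ => ?_
  have h1 : ‖(ζ : ℂ)‖ = 1 := by simp
  have h2 : ‖w‖ < 1 := by simpa using hw
  have : (ζ : ℂ) - w ≠ 0 := by
    intro h0
    rw [sub_eq_zero.1 h0] at h1
    linarith
  positivity

open Metric in
/-- A function holomorphic on the unit disc and continuous up to the boundary with nonnegative real
part is the Poisson integral of a finite measure on the unit circle. -/
theorem exists_measure_poisson_of_diffContOnCl {h : ℂ → ℂ} (hd : DiffContOnCl ℂ h (ball 0 1))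
    (hpos : ∀ w ∈ closedBall (0 : ℂ) 1, 0 ≤ (h w).re) :
    ∃ m : FiniteMeasure (sphere (0 : ℂ) 1), ∀ w ∈ ball (0 : ℂ) 1,
      ∫ ζ, poissonKernel 0 w ζ ∂(m : Measure (sphere (0 : ℂ) 1)) = (h w).re := by
  have hmem : ∀ θ : ℝ, circleMap 0 1 θ ∈ sphere (0 : ℂ) 1 := fun θ => by simp
  set p : ℝ → sphere (0 : ℂ) 1 := fun θ => ⟨circleMap 0 1 θ, hmem θ⟩ with hp
  have hpc : Continuous p := (continuous_circleMap 0 1).subtype_mk _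
  set g : ℝ → ℝ := fun θ => (2 * Real.pi)⁻¹ * (h (circleMap 0 1 θ)).re with hg
  have hhc : Continuous fun θ => h (circleMap 0 1 θ) := by
    refine hd.continuousOn_ball.comp_continuous (continuous_circleMap 0 1) fun θ => ?_
    exact sphere_subset_closedBall (hmem θ)
  have hgc : Continuous g := continuous_const.mul (Complex.continuous_re.comp hhc)
  have hg0 : ∀ θ, 0 ≤ g θ := fun θ =>
    mul_nonneg (by positivity) (hpos _ (sphere_subset_closedBall (hmem θ)))
  set v : Measure ℝ := volume.restrict (Set.Ioc 0 (2 * Real.pi)) with hv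
  have hfin : IsFiniteMeasure (v.withDensity fun θ => ENNReal.ofReal (g θ)) := by
    refine isFiniteMeasure_withDensity_ofReal ?_
    exact (hgc.integrableOn_Ioc).2
  refine ⟨⟨(v.withDensity fun θ => ENNReal.ofReal (g θ)).map p, inferInstance⟩, fun w hw => ?_⟩
  have hPc := continuous_poissonKernel_sphere hw
  have key := hd.circleAverage_poissonKernel_smul hw
  rw [FiniteMeasure.toMeasure_mk, integral_map hpc.aemeasurable hPc.aestronglyMeasurable]
  have := integral_withDensity_eq_integral_smul (μ := v) (f := fun θ => (g θ).toNNReal)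
    (hgc.measurable.real_toNNReal) (fun θ => poissonKernel 0 w (p θ))
  refine this.trans ?_
  rw [← key, Real.circleAverage_def, intervalIntegral.integral_of_le (by positivity)]
  have h_int : Integrable (fun θ => (poissonKernel 0 w • h) (circleMap 0 1 θ)) v := by
    refine Continuous.integrableOn_Ioc ?_
    exact (hPc.comp hpc).smul hhc
  have h3 := integral_re (𝕜 := ℂ) h_int
  simp only [RCLike.re_eq_complex_re] at h3
  rw [Complex.smul_re, ← h3, smul_eq_mul, ← integral_const_mul]
  refine integral_congr_ae (Filter.Eventually.of_forall fun θ => ?_)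
  beta_reduce
  rw [NNReal.smul_def, Real.coe_toNNReal _ (hg0 θ)]
  simp only [smul_eq_mul, hp, hg, Pi.smul_apply', Complex.smul_re]
  ring

open Metric Filter Topology in
/-- **Herglotz representation theorem**: a function holomorphic on the unit disc with nonnegative
real part is the Poisson integral of a finite measure on the unit circle. -/
theorem exists_measure_poisson {h : ℂ → ℂ} (hd : DifferentiableOn ℂ h (ball 0 1))
    (hpos : ∀ w ∈ ball (0 : ℂ) 1, 0 ≤ (h w).re) :
    ∃ m : FiniteMeasure (sphere (0 : ℂ) 1), ∀ w ∈ ball (0 : ℂ) 1,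
      ∫ ζ, poissonKernel 0 w ζ ∂(m : Measure (sphere (0 : ℂ) 1)) = (h w).re := by
  set r : ℕ → ℝ := fun n => 1 - 1 / ((n : ℝ) + 1) with hr
  have hr0 : ∀ n, 0 ≤ r n := fun n => by
    have : 1 / ((n : ℝ) + 1) ≤ 1 := by
      rw [div_le_one (by positivity)]
      linarith [(Nat.cast_nonneg n : (0 : ℝ) ≤ n)]
    simp only [hr]; linarith
  have hr1 : ∀ n, r n < 1 := fun n => by
    have : 0 < 1 / ((n : ℝ) + 1) := by positivity
    simp only [hr]; linarith
  have hrt : Tendsto r atTop (𝓝 1) := by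
    simpa [hr] using tendsto_one_div_add_atTop_nhds_zero_nat.const_sub (1 : ℝ)
  have hmaps : ∀ n, Set.MapsTo (fun w : ℂ => (r n : ℂ) * w) (closedBall 0 1) (ball 0 1) := by
    intro n w hw
    have hw' : ‖w‖ ≤ 1 := by simpa using hw
    simp only [mem_ball, dist_zero_right, norm_mul, Complex.norm_real, Real.norm_eq_abs,
      abs_of_nonneg (hr0 n)]
    nlinarith [hr0 n, hr1 n, norm_nonneg w]
  have hex : ∀ n, ∃ m : FiniteMeasure (sphere (0 : ℂ) 1), ∀ w ∈ ball (0 : ℂ) 1,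
      ∫ ζ, poissonKernel 0 w ζ ∂(m : Measure (sphere (0 : ℂ) 1)) = (h (r n * w)).re := by
    intro n
    refine exists_measure_poisson_of_diffContOnCl (h := fun w => h (r n * w)) ?_
      fun w hw => hpos _ (hmaps n hw)
    refine DifferentiableOn.diffContOnCl_ball (U := closedBall 0 1) ?_ subset_rfl
    exact hd.comp (by fun_prop) (hmaps n)
  choose m hm using hex
  have hmass : ∀ n, (m n).mass = ((h 0).re).toNNReal := by
    intro n
    have h1 := hm n 0 (by simp)
    have h2 : ∀ ζ : sphere (0 : ℂ) 1, poissonKernel 0 0 (ζ : ℂ) = 1 := fun ζ => by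
      have : ‖(ζ : ℂ)‖ = 1 := by simp
      simp [poissonKernel_def]
    simp only [h2, integral_const, smul_eq_mul, mul_one, mul_zero] at h1
    rw [← h1]
    exact (Real.toNNReal_coe (r := (m n).mass)).symm
  obtain ⟨m', -, hm'⟩ := (isCompact_setOfPred_finiteMeasure_le_of_compactSpace
    (sphere (0 : ℂ) 1) ((h 0).re).toNNReal).ultrafilter_le_nhds ((hyperfilter ℕ).map m) (by
      simp only [Ultrafilter.coe_map, le_principal_iff, mem_map]
      exact Filter.univ_mem' fun n => (hmass n).le)
  have htend : Tendsto m (hyperfilter ℕ : Filter ℕ) (𝓝 m') := hm'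
  rw [FiniteMeasure.tendsto_iff_forall_integral_tendsto] at htend
  refine ⟨m', fun w hw => ?_⟩
  have hPc := continuous_poissonKernel_sphere hw
  have h1 := htend (BoundedContinuousFunction.mkOfCompact ⟨_, hPc⟩)
  simp only [BoundedContinuousFunction.mkOfCompact_apply, ContinuousMap.coe_mk, hm _ w hw] at h1
  have h2 : Tendsto (fun n => (h (r n * w)).re) atTop (𝓝 (h w).re) := by
    have hc : ContinuousAt h w := (hd.differentiableAt (isOpen_ball.mem_nhds hw)).continuousAt
    refine (Complex.continuous_re.tendsto _).comp (hc.tendsto.comp ?_)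
    have : Tendsto (fun n => (r n : ℂ)) atTop (𝓝 1) := by
      exact_mod_cast (Complex.continuous_ofReal.tendsto 1).comp hrt
    simpa using this.mul_const w
  exact tendsto_nhds_unique h1 (h2.mono_left (by
    rw [← Nat.cofinite_eq_atTop]; exact hyperfilter_le_cofinite))

theorem im_I_mul_one_add_div_one_sub (w : ℂ) :
    (Complex.I * (1 + w) / (1 - w)).im = (1 - ‖w‖ ^ 2) / ‖1 - w‖ ^ 2 := by
  rw [← Complex.normSq_eq_norm_sq, ← Complex.normSq_eq_norm_sq, Complex.div_im, Complex.normSq_apply w]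
  simp
  ring

theorem norm_sub_I_lt_norm_add_I {z : ℂ} (hz : 0 < z.im) : ‖z - Complex.I‖ < ‖z + Complex.I‖ := by
  rw [← sq_lt_sq₀ (norm_nonneg _) (norm_nonneg _), ← Complex.normSq_eq_norm_sq,
    ← Complex.normSq_eq_norm_sq, Complex.normSq_apply, Complex.normSq_apply]
  simp
  nlinarith

theorem poissonKernel_cayley {z ζ : ℂ} (hz : 0 < z.im) (hζ : ‖ζ‖ = 1) :
    poissonKernel 0 ((z - Complex.I) / (z + Complex.I)) ζ
      = 4 * z.im / ‖z * (ζ - 1) + Complex.I * (ζ + 1)‖ ^ 2 := by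
  have h0 : 0 < ‖z + Complex.I‖ := (norm_nonneg _).trans_lt (norm_sub_I_lt_norm_add_I hz)
  have h1 : z + Complex.I ≠ 0 := norm_pos_iff.1 h0
  have h2 : ζ - (z - Complex.I) / (z + Complex.I)
      = (z * (ζ - 1) + Complex.I * (ζ + 1)) / (z + Complex.I) := by
    field_simp
    ring
  have h3 : ‖z + Complex.I‖ ^ 2 - ‖z - Complex.I‖ ^ 2 = 4 * z.im := by
    rw [← Complex.normSq_eq_norm_sq, ← Complex.normSq_eq_norm_sq, Complex.normSq_apply,
      Complex.normSq_apply]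
    simp
    ring
  rw [poissonKernel_def]
  simp only [sub_zero]
  rw [h2, hζ, norm_div, norm_div, ← h3, div_pow, div_pow]
  field_simp

open Metric in
/-- Poisson representation on the upper half-plane, with boundary points parametrized by the unit
circle. -/
theorem exists_measure_poisson_upperHalfPlane {G : ℂ → ℂ}
    (hG : DifferentiableOn ℂ G {z | 0 < z.im}) (hneg : ∀ z : ℂ, 0 < z.im → (G z).im ≤ 0) :
    ∃ m : FiniteMeasure (sphere (0 : ℂ) 1), ∀ z : ℂ, 0 < z.im →
      ∫ ζ, 4 * z.im / ‖z * ((ζ : ℂ) - 1) + Complex.I * (ζ + 1)‖ ^ 2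
        ∂(m : Measure (sphere (0 : ℂ) 1)) = -(G z).im := by
  have hne : ∀ w ∈ ball (0 : ℂ) 1, 1 - w ≠ 0 := fun w hw h => by
    simp [← sub_eq_zero.1 h] at hw
  have hmaps : Set.MapsTo (fun w : ℂ => Complex.I * (1 + w) / (1 - w)) (ball 0 1)
      {z | 0 < z.im} := fun w hw => by
    have h1 : 0 < ‖1 - w‖ := norm_pos_iff.2 (hne w hw)
    have h2 : ‖w‖ < 1 := by simpa using hw
    simp only [Set.mem_ofPred_eq, im_I_mul_one_add_div_one_sub]
    have : 0 < 1 - ‖w‖ ^ 2 := by nlinarith [norm_nonneg w]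
    positivity
  obtain ⟨m, hm⟩ := exists_measure_poisson
    (h := fun w => Complex.I * G (Complex.I * (1 + w) / (1 - w)))
    ((hG.comp (DifferentiableOn.div (by fun_prop) (by fun_prop) hne) hmaps).const_mul _)
    (fun w hw => by simpa using hneg _ (hmaps hw))
  refine ⟨m, fun z hz => ?_⟩
  have h0 : 0 < ‖z + Complex.I‖ := (norm_nonneg _).trans_lt (norm_sub_I_lt_norm_add_I hz)
  have h1 : z + Complex.I ≠ 0 := norm_pos_iff.1 h0
  have h2 := hm ((z - Complex.I) / (z + Complex.I)) (by
    rw [mem_ball_zero_iff, norm_div, div_lt_one h0]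
    exact norm_sub_I_lt_norm_add_I hz)
  have h3 : Complex.I * (1 + (z - Complex.I) / (z + Complex.I))
      / (1 - (z - Complex.I) / (z + Complex.I)) = z := by
    have : 1 - (z - Complex.I) / (z + Complex.I) = 2 * Complex.I / (z + Complex.I) := by
      field_simp
      ring
    rw [this]
    field_simp [Complex.I_ne_zero]
    ring
  rw [h3] at h2
  rw [show -(G z).im = (Complex.I * G z).re by simp, ← h2]
  refine integral_congr_ae (Filter.Eventually.of_forall fun ζ => ?_)
  exact (poissonKernel_cayley hz (by simp)).symm

open Metric Filter Topology in
/-- A measure on the circle whose half-plane Poisson integral decays like `1 / y` along the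
imaginary axis integrates the singular weight `4 / ‖ζ - 1‖ ^ 2` to `1`. -/
theorem lintegral_inv_norm_sub_one_sq {m : Measure (sphere (0 : ℂ) 1)} [IsFiniteMeasure m]
    (hm : Tendsto (fun y : ℝ => y * ∫ ζ : sphere (0 : ℂ) 1,
      4 * y / ‖(y * Complex.I) * ((ζ : ℂ) - 1) + Complex.I * (ζ + 1)‖ ^ 2 ∂m) atTop (𝓝 1)) :
    ∫⁻ ζ : sphere (0 : ℂ) 1, (ENNReal.ofReal (‖(ζ : ℂ) - 1‖ ^ 2 / 4))⁻¹ ∂m = 1 := by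
  have hpar : ∀ ζ : sphere (0 : ℂ) 1, ‖(ζ : ℂ) + 1‖ ^ 2 = 4 - ‖(ζ : ℂ) - 1‖ ^ 2 := fun ζ => by
    have h1 := parallelogram_law_with_norm ℝ (ζ : ℂ) 1
    have h2 : ‖(ζ : ℂ)‖ = 1 := by simp
    rw [h2, norm_one] at h1
    linarith
  have hle : ∀ ζ : sphere (0 : ℂ) 1, ‖(ζ : ℂ) - 1‖ ^ 2 ≤ 4 := fun ζ => by
    have := hpar ζ
    nlinarith [sq_nonneg ‖(ζ : ℂ) + 1‖]
  set d : ℝ → sphere (0 : ℂ) 1 → ℝ := fun y ζ =>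
    ‖(ζ : ℂ) - 1‖ ^ 2 / 4 + ‖(ζ : ℂ) + 1‖ ^ 2 / 4 * y⁻¹ ^ 2 with hd
  have hdpos : ∀ y : ℝ, 0 < y → ∀ ζ, 0 < d y ζ := fun y hy ζ => by
    simp only [hd, hpar]
    have hy' : 0 < y⁻¹ ^ 2 := by positivity
    rcases (sq_nonneg ‖(ζ : ℂ) - 1‖).eq_or_lt with h | h
    · rw [← h]; linarith
    · have := hle ζ
      have : 0 ≤ (4 - ‖(ζ : ℂ) - 1‖ ^ 2) / 4 * y⁻¹ ^ 2 := by
        refine mul_nonneg ?_ hy'.le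
        linarith
      linarith
  have hdc : ∀ y, Continuous (d y) := fun y => by fun_prop
  have hker : ∀ y : ℝ, 0 < y → ∀ ζ : sphere (0 : ℂ) 1,
      y * (4 * y / ‖(y * Complex.I) * ((ζ : ℂ) - 1) + Complex.I * (ζ + 1)‖ ^ 2) = (d y ζ)⁻¹ := by
    intro y hy ζ
    have h1 : ‖(y * Complex.I) * ((ζ : ℂ) - 1) + Complex.I * (ζ + 1)‖ ^ 2 = 4 * y ^ 2 * d y ζ := by
      have h2 : (y * Complex.I) * ((ζ : ℂ) - 1) + Complex.I * (ζ + 1)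
        = Complex.I * (y * ((ζ : ℂ) - 1) + (ζ + 1)) := by ring
      have h3 : 4 * y ^ 2 * d y ζ = y ^ 2 * ‖(ζ : ℂ) - 1‖ ^ 2 + ‖(ζ : ℂ) + 1‖ ^ 2 := by
        simp only [hd]
        field_simp
      have h4 : (ζ : ℂ).re * (ζ : ℂ).re + (ζ : ℂ).im * (ζ : ℂ).im = 1 := by
        rw [← Complex.normSq_apply, Complex.normSq_eq_norm_sq]
        simp
      rw [h2, h3, norm_mul, Complex.norm_I, one_mul, ← Complex.normSq_eq_norm_sq,
        ← Complex.normSq_eq_norm_sq, ← Complex.normSq_eq_norm_sq, Complex.normSq_apply,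
        Complex.normSq_apply, Complex.normSq_apply]
      simp
      linear_combination (2 * y) * h4
    have := (hdpos y hy ζ).ne'
    rw [h1]
    field_simp
  have h_int : ∀ y : ℝ, 0 < y → ENNReal.ofReal (y * ∫ ζ : sphere (0 : ℂ) 1,
      4 * y / ‖(y * Complex.I) * ((ζ : ℂ) - 1) + Complex.I * (ζ + 1)‖ ^ 2 ∂m)
      = ∫⁻ ζ, (ENNReal.ofReal (d y ζ))⁻¹ ∂m := by
    intro y hy
    rw [← integral_const_mul]
    simp only [hker y hy]
    have hc : Continuous fun ζ => (d y ζ)⁻¹ := (hdc y).inv₀ fun ζ => (hdpos y hy ζ).ne'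
    rw [ofReal_integral_eq_lintegral_ofReal]
    · exact lintegral_congr fun ζ => ENNReal.ofReal_inv_of_pos (hdpos y hy ζ)
    · exact hc.integrable_of_hasCompactSupport (HasCompactSupport.of_compactSpace _)
    · exact Eventually.of_forall fun ζ => (inv_pos.2 (hdpos y hy ζ)).le
  have hseq : Tendsto (fun n : ℕ => (n : ℝ) + 1) atTop atTop :=
    tendsto_atTop_add_const_right _ _ tendsto_natCast_atTop_atTop
  have hmono : Tendsto (fun n : ℕ => ∫⁻ ζ, (ENNReal.ofReal (d ((n : ℝ) + 1) ζ))⁻¹ ∂m) atTop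
      (𝓝 (∫⁻ ζ : sphere (0 : ℂ) 1, (ENNReal.ofReal (‖(ζ : ℂ) - 1‖ ^ 2 / 4))⁻¹ ∂m)) := by
    refine lintegral_tendsto_of_tendsto_of_monotone
      (fun n => ((hdc _).measurable.ennreal_ofReal.inv).aemeasurable) ?_ ?_
    · refine Eventually.of_forall fun ζ i j hij => ?_
      refine ENNReal.inv_le_inv.2 (ENNReal.ofReal_le_ofReal ?_)
      simp only [hd]
      gcongr
    · refine Eventually.of_forall fun ζ => ?_
      refine (continuous_inv.tendsto _).comp ((ENNReal.continuous_ofReal.tendsto _).comp ?_)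
      have h1 := ((tendsto_inv_atTop_zero.comp hseq).pow 2).const_mul (‖(ζ : ℂ) + 1‖ ^ 2 / 4)
      simpa [hd, Function.comp_def] using h1.const_add (‖(ζ : ℂ) - 1‖ ^ 2 / 4)
  refine tendsto_nhds_unique hmono ?_
  have h1 := (ENNReal.continuous_ofReal.tendsto _).comp (hm.comp hseq)
  rw [ENNReal.ofReal_one] at h1
  refine h1.congr fun n => ?_
  exact h_int _ (by positivity)

open Metric in
/-- The half-plane Poisson integral of a measure on the circle integrating `4 / ‖ζ - 1‖ ^ 2` to `1`
is, up to sign, the imaginary part of the Cauchy transform of a probability measure. -/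
theorem exists_neg_im_cauchyTransform_eq {m : Measure (sphere (0 : ℂ) 1)}
    (hm : ∫⁻ ζ : sphere (0 : ℂ) 1, (ENNReal.ofReal (‖(ζ : ℂ) - 1‖ ^ 2 / 4))⁻¹ ∂m = 1) :
    ∃ l : Measure ℝ, IsProbabilityMeasure l ∧ ∀ z : ℂ, 0 < z.im →
      -(cauchyTransform l z).im
        = ∫ ζ : sphere (0 : ℂ) 1, 4 * z.im / ‖z * ((ζ : ℂ) - 1) + Complex.I * (ζ + 1)‖ ^ 2 ∂m := by
  set F : sphere (0 : ℂ) 1 → ENNReal := fun ζ => (ENNReal.ofReal (‖(ζ : ℂ) - 1‖ ^ 2 / 4))⁻¹ with hF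
  have hFm : Measurable F := by fun_prop
  have hFfin : ∀ᵐ ζ ∂m, F ζ < ⊤ := ae_lt_top hFm (by rw [hm]; simp)
  set T : sphere (0 : ℂ) 1 → ℝ := fun ζ => (Complex.I * (1 + ζ) / (1 - ζ)).re with hT
  have hTm : Measurable T := by fun_prop
  have hprob : IsProbabilityMeasure (m.withDensity F) :=
    ⟨by rw [withDensity_apply _ MeasurableSet.univ, Measure.restrict_univ, hm]⟩
  have hl : IsProbabilityMeasure ((m.withDensity F).map T) :=
    Measure.isProbabilityMeasure_map hTm.aemeasurable
  refine ⟨_, hl, fun z hz => ?_⟩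
  have hcont : Continuous fun t : ℝ => z.im * ‖(z - t)⁻¹‖ ^ 2 :=
    continuous_const.mul ((continuous_inv_sub_ofReal hz).norm.pow 2)
  rw [neg_im_cauchyTransform _ hz, integral_map hTm.aemeasurable hcont.aestronglyMeasurable,
    integral_withDensity_eq_integral_toReal_smul hFm hFfin]
  refine integral_congr_ae ?_
  filter_upwards [hFfin] with ζ hζ
  have h1 : (1 : ℂ) - ζ ≠ 0 := fun h => by
    simp [hF, ← sub_eq_zero.1 h] at hζ
  have h2 : (T ζ : ℂ) = Complex.I * (1 + ζ) / (1 - ζ) := by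
    refine Complex.ext (by simp [hT]) ?_
    rw [im_I_mul_one_add_div_one_sub]
    simp
  have h3 : 0 < ‖(1 : ℂ) - ζ‖ := norm_pos_iff.2 h1
  have h4 : z - T ζ = -(z * ((ζ : ℂ) - 1) + Complex.I * (ζ + 1)) / (1 - ζ) := by
    rw [h2]
    field_simp
    ring
  have h5 : (F ζ).toReal = 4 / ‖(1 : ℂ) - ζ‖ ^ 2 := by
    simp only [hF]
    rw [ENNReal.toReal_inv, ENNReal.toReal_ofReal (by positivity), inv_div, norm_sub_rev]
  rw [h4, h5, norm_inv, norm_div, norm_neg, smul_eq_mul, inv_div, div_pow]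
  field_simp

open Filter Topology in
/-- A holomorphic function on the upper half-plane with nonpositive imaginary part and
`iy * G (iy) → 1` is the Cauchy transform of a probability measure. -/
theorem exists_cauchyTransform_eq {G : ℂ → ℂ}
    (hG : DifferentiableOn ℂ G {z | 0 < z.im}) (hneg : ∀ z : ℂ, 0 < z.im → (G z).im ≤ 0)
    (hlim : Tendsto (fun y : ℝ => y * Complex.I * G (y * Complex.I)) atTop (𝓝 1)) :
    ∃ l : Measure ℝ, IsProbabilityMeasure l ∧ ∀ z : ℂ, 0 < z.im → cauchyTransform l z = G z := by
  obtain ⟨m, hm⟩ := exists_measure_poisson_upperHalfPlane hG hneg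
  have hmass := lintegral_inv_norm_sub_one_sq (m := (m : Measure (Metric.sphere (0 : ℂ) 1))) (by
    have h1 := (Complex.continuous_re.tendsto _).comp hlim
    rw [Complex.one_re] at h1
    refine h1.congr' ?_
    filter_upwards [eventually_gt_atTop 0] with y hy
    have h2 := hm (y * Complex.I) (by simpa using hy)
    simp only [Complex.im_ofReal_mul, Complex.I_im, mul_one] at h2
    rw [h2]
    simp [mul_assoc])
  obtain ⟨l, hl, hlm⟩ := exists_neg_im_cauchyTransform_eq hmass
  refine ⟨l, hl, ?_⟩
  have hopen : IsOpen {z : ℂ | 0 < z.im} := isOpen_lt continuous_const Complex.continuous_im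
  have hconn : IsConnected {z : ℂ | 0 < z.im} :=
    ⟨⟨Complex.I, by simp⟩, (convex_halfSpace_im_gt 0).isPreconnected⟩
  obtain ⟨c, hc⟩ := AnalyticOnNhd.eq_const_of_im_eq_const (c₀ := 0)
    (((differentiableOn_cauchyTransform l).sub hG).analyticOnNhd hopen) (fun z hz => by
      have h1 := hlm z hz
      rw [hm z hz] at h1
      simp only [Pi.sub_apply, Complex.sub_im]
      linarith) hopen hconn
  have h1 := (tendsto_mul_cauchyTransform l).sub hlim
  have h2 : Tendsto (fun y : ℝ => ((y : ℂ) * Complex.I)⁻¹) atTop (𝓝 0) := by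
    rw [tendsto_zero_iff_norm_tendsto_zero]
    simpa [Function.comp_def] using tendsto_inv_atTop_zero.comp (tendsto_abs_atTop_atTop (G := ℝ))
  have h3 : Tendsto (fun _ : ℝ => c) atTop (𝓝 0) := by
    have h4 := h2.mul h1
    rw [sub_self, mul_zero] at h4
    refine h4.congr' ?_
    filter_upwards [eventually_gt_atTop 0] with y hy
    have h5 : (y : ℂ) * Complex.I ≠ 0 := by simp [hy.ne']
    rw [← hc (y * Complex.I) (by simpa using hy), ← mul_sub, inv_mul_cancel_left₀ h5]
    rfl
  have hc0 : c = 0 := tendsto_nhds_unique tendsto_const_nhds h3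
  intro z hz
  have := hc z hz
  rw [hc0] at this
  exact sub_eq_zero.1 this

/-- Existence and uniqueness of the additive boolean convolution `μ ⊎ ν`: the unique
probability measure `λ` on `ℝ` with
`G_λ(z) = G_μ(z)·G_ν(z)/(G_μ(z)+G_ν(z)−z·G_μ(z)·G_ν(z))`, i.e. `F_λ = F_μ + F_ν − z`,
on the upper half-plane. -/
theorem boolean_additive_convolution_exists_unique
    (μ ν : Measure ℝ) [IsProbabilityMeasure μ] [IsProbabilityMeasure ν] :
    ∃! l : Measure ℝ, IsProbabilityMeasure l ∧
      ∀ z : ℂ, 0 < z.im →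
        cauchyTransform l z
          = cauchyTransform μ z * cauchyTransform ν z /
              (cauchyTransform μ z + cauchyTransform ν z
                - z * cauchyTransform μ z * cauchyTransform ν z) := by
  set H : ℂ → ℂ := fun z => (cauchyTransform μ z)⁻¹ + (cauchyTransform ν z)⁻¹ - z with hH
  have hHim : ∀ z : ℂ, 0 < z.im → 0 < (H z).im := fun z hz => by
    have h1 := im_le_im_inv_cauchyTransform μ hz
    have h2 := im_le_im_inv_cauchyTransform ν hz
    simp only [hH, Complex.sub_im, Complex.add_im]
    linarith
  have hH0 : ∀ z : ℂ, 0 < z.im → H z ≠ 0 := fun z hz h => by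
    simpa [h] using hHim z hz
  have hHinv : ∀ z : ℂ, 0 < z.im → (H z)⁻¹ = cauchyTransform μ z * cauchyTransform ν z /
      (cauchyTransform μ z + cauchyTransform ν z
        - z * cauchyTransform μ z * cauchyTransform ν z) := fun z hz => by
    have h1 := cauchyTransform_ne_zero μ hz
    have h2 := cauchyTransform_ne_zero ν hz
    rw [← inv_div]
    congr 1
    simp only [hH]
    field_simp
    ring
  obtain ⟨l, hl, hlH⟩ := exists_cauchyTransform_eq (G := fun z => (H z)⁻¹)
    (((((differentiableOn_cauchyTransform μ).inv fun z hz => cauchyTransform_ne_zero μ hz).add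
      ((differentiableOn_cauchyTransform ν).inv fun z hz => cauchyTransform_ne_zero ν hz)).sub
        differentiableOn_id).inv hH0)
    (fun z hz => by
      rw [Complex.inv_im]
      exact div_nonpos_of_nonpos_of_nonneg (neg_nonpos.2 (hHim z hz).le) (Complex.normSq_nonneg _))
    (by
      have h1 := (((tendsto_mul_cauchyTransform μ).inv₀ one_ne_zero).add
        ((tendsto_mul_cauchyTransform ν).inv₀ one_ne_zero)).sub_const 1 |>.inv₀ (by simp)
      rw [inv_one, add_sub_cancel_right, inv_one] at h1
      refine h1.congr' ?_
      filter_upwards [Filter.eventually_gt_atTop 0] with y hy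
      have h5 : (y : ℂ) * Complex.I ≠ 0 := by simp [hy.ne']
      simp only [hH]
      generalize (y : ℂ) * Complex.I = w at h5
      rw [mul_inv w, mul_inv w, ← mul_add, ← inv_mul_cancel₀ h5, ← mul_sub, mul_inv, inv_inv])
  refine ⟨l, ⟨hl, fun z hz => (hlH z hz).trans (hHinv z hz)⟩, fun l' ⟨hl', h⟩ => ?_⟩
  exact Measure.ext_of_cauchyTransform fun z hz =>
    (h z hz).trans ((hlH z hz).trans (hHinv z hz)).symm
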